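/- Let $\omega \in A_1$ and $1 < p < \infty$. Define $\|f\|_{BMO_X(\omega)} = \sup_Q \omega(Q)^{-1/p}\,\|(f - f_Q)\,\omega^{-1}\chi_Q\|_{L^{p,\infty}(\omega)}$, using the weak-$L^p$ quasinorm with respect to the measure $\omega\,dx$. Then $\|f\|_{BMO_X(\omega)}$ is equivalent to $\|f\|_{BMO(\omega)} = \sup_Q \frac{1}{\omega(Q)}\int_Q |f - f_Q|\,dx$: there exists $C \geq 1$ with $C^{-1}\|f\|_{BMO(\omega)} \leq \|f\|_{BMO_X(\omega)} \leq C\,\|f\|_{BMO(\omega)}$. -/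

import Mathlib

open MeasureTheory Real
noncomputable section

abbrev Rn (n : ℕ) := EuclideanSpace ℝ (Fin n)

def cube {n : ℕ} (c : Rn n) (r : ℝ) : Set (Rn n) := {y | ∀ i, |y i - c i| ≤ r / 2}

def wMeas {n : ℕ} (ω : Rn n → ℝ) (S : Set (Rn n)) : ℝ := ∫ x in S, ω x

def avg {n : ℕ} (f : Rn n → ℝ) (c : Rn n) (r : ℝ) : ℝ := (∫ x in cube c r, f x) / r ^ n

def IsA1 {n : ℕ} (ω : Rn n → ℝ) (A : ℝ) : Prop :=
  (∀ x, 0 < ω x) ∧ LocallyIntegrable ω volume ∧ 1 ≤ A ∧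
  ∀ (c : Rn n) (r : ℝ), 0 < r →
    ∀ᵐ x ∂(volume : Measure (Rn n)), x ∈ cube c r → wMeas ω (cube c r) / r ^ n ≤ A * ω x

def IsAp {n : ℕ} (ω : Rn n → ℝ) (p A : ℝ) : Prop :=
  (∀ x, 0 < ω x) ∧ LocallyIntegrable ω volume ∧
  ∀ (c : Rn n) (r : ℝ), 0 < r →
    (wMeas ω (cube c r) / r ^ n) *
      ((∫ x in cube c r, ω x ^ (-(1 / (p - 1)))) / r ^ n) ^ (p - 1) ≤ A

def IsAinf {n : ℕ} (ω : Rn n → ℝ) : Prop := ∃ p A, 1 < p ∧ IsAp ω p A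
/-- half-open box -/
def BB {n : ℕ} (b : Fin n → ℝ) (s : ℝ) : Set (Fin n → ℝ) :=
  Set.univ.pi fun i => Set.Ico (b i) (b i + s)

def chd {n : ℕ} (b : Fin n → ℝ) (s : ℝ) (σ : Fin n → Bool) : Fin n → ℝ :=
  fun i => b i + if σ i then s / 2 else 0

lemma mem_BB {n : ℕ} {b : Fin n → ℝ} {s : ℝ} {x : Fin n → ℝ} :
    x ∈ BB b s ↔ ∀ i, b i ≤ x i ∧ x i < b i + s := by
  simp [BB]

lemma BB_meas {n : ℕ} (b : Fin n → ℝ) (s : ℝ) : MeasurableSet (BB b s) :=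
  MeasurableSet.univ_pi fun _ => measurableSet_Ico

lemma BB_chd_sub {n : ℕ} (b : Fin n → ℝ) {s : ℝ} (hs : 0 < s) (σ : Fin n → Bool) :
    BB (chd b s σ) (s / 2) ⊆ BB b s := by
  intro x hx
  rw [mem_BB] at hx ⊢
  intro i
  have := hx i
  unfold chd at this
  split_ifs at this <;> constructor <;> linarith

lemma BB_exists_chd {n : ℕ} (b : Fin n → ℝ) {s : ℝ} {x : Fin n → ℝ}
    (hx : x ∈ BB b s) : ∃ σ, x ∈ BB (chd b s σ) (s / 2) := by
  classical
  refine ⟨fun i => decide (b i + s / 2 ≤ x i), ?_⟩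
  rw [mem_BB] at hx ⊢
  intro i
  have := hx i
  unfold chd
  by_cases h : b i + s / 2 ≤ x i
  · constructor <;> simp [h] <;> linarith
  · simp only [h, decide_false]
    push Not at h
    constructor <;> simp <;> linarith

lemma BB_chd_disj {n : ℕ} (b : Fin n → ℝ) (s : ℝ) :
    Pairwise (Function.onFun Disjoint fun σ => BB (chd b s σ) (s / 2)) := by
  intro σ τ hne
  rw [Function.onFun, Set.disjoint_left]
  intro x hx hy
  apply hne
  rw [mem_BB] at hx hy
  funext i
  have h1 := hx i
  have h2 := hy i
  unfold chd at h1 h2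
  cases hσ : σ i <;> cases hτ : τ i <;> simp [hσ, hτ] at h1 h2 ⊢ <;> linarith

lemma BB_ae_Icc {n : ℕ} (b : Fin n → ℝ) (s : ℝ) :
    BB b s =ᵐ[volume] Set.Icc b (fun i => b i + s) := by
  exact Measure.univ_pi_Ico_ae_eq_Icc

lemma BB_ae_ball {n : ℕ} (b : Fin n → ℝ) {s : ℝ} (hs : 0 < s) :
    BB b s =ᵐ[volume] Metric.closedBall (fun i => b i + s / 2) (s / 2) := by
  have : Metric.closedBall (fun i => b i + s / 2) (s / 2) = Set.Icc b (fun i => b i + s) := by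
    rw [closedBall_pi _ (by positivity)]
    ext x
    simp only [Set.mem_pi, Set.mem_univ, true_imp_iff, Real.closedBall_eq_Icc, Set.mem_Icc,
      Pi.le_def]
    constructor
    · intro h
      exact ⟨fun i => by linarith [(h i).1], fun i => by linarith [(h i).2]⟩
    · intro h i
      constructor <;> linarith [h.1 i, h.2 i]
  rw [this]
  exact BB_ae_Icc b s

lemma BB_vol {n : ℕ} (b : Fin n → ℝ) {s : ℝ} (hs : 0 < s) :
    volume (BB b s) = ENNReal.ofReal (s ^ n) := by
  rw [BB, Real.volume_pi_Ico]
  simp [ENNReal.ofReal_pow hs.le]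

lemma BB_int {n : ℕ} {g : (Fin n → ℝ) → ℝ} (hg : LocallyIntegrable g volume)
    (b : Fin n → ℝ) (s : ℝ) : IntegrableOn g (BB b s) volume :=
  (hg.integrableOn_isCompact isCompact_Icc).congr_set_ae (BB_ae_Icc b s)

open Classical in
def GG {n : ℕ} (sel : (Fin n → ℝ) → ℝ → Prop) : ℕ → (Fin n → ℝ) → ℝ → Set (Fin n → ℝ)
  | 0, _, _ => ∅
  | k + 1, b, s => ⋃ σ : Fin n → Bool,
      if sel (chd b s σ) (s / 2) then BB (chd b s σ) (s / 2) else GG sel k (chd b s σ) (s / 2)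

lemma GG_mono {n : ℕ} (sel : (Fin n → ℝ) → ℝ → Prop) (k : ℕ) :
    ∀ b s, GG sel k b s ⊆ GG sel (k + 1) b s := by
  induction k with
  | zero => intro b s; simp [GG]
  | succ k ih =>
    intro b s
    rw [GG, GG]
    apply Set.iUnion_mono
    intro σ
    split_ifs
    · exact le_rfl
    · exact ih _ _

lemma GG_chain {n : ℕ} (sel : (Fin n → ℝ) → ℝ → Prop) (x : Fin n → ℝ) (k : ℕ) :
    ∀ b s, 0 < s → ¬ sel b s → x ∈ BB b s → x ∉ GG sel k b s →
      ∃ b', ¬ sel b' (s / 2 ^ k) ∧ x ∈ BB b' (s / 2 ^ k) := by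
  induction k with
  | zero => intro b s hs h1 h2 _; exact ⟨b, by simpa using h1, by simpa using h2⟩
  | succ k ih =>
    intro b s hs h1 h2 h3
    obtain ⟨σ, hσ⟩ := BB_exists_chd b h2
    rw [GG, Set.mem_iUnion, not_exists] at h3
    have h4 := h3 σ
    split_ifs at h4 with h5
    · exact absurd hσ h4
    · have := ih _ (s / 2) (by positivity) h5 hσ h4
      have e : s / 2 / 2 ^ k = s / 2 ^ (k + 1) := by rw [pow_succ]; field_simp
      rwa [e] at this

lemma wd_eq {n : ℕ} {g : (Fin n → ℝ) → ℝ} {S : Set (Fin n → ℝ)} (hg : IntegrableOn g S volume)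
    (h0 : ∀ x, 0 ≤ g x) :
    (volume.withDensity fun x => ENNReal.ofReal (g x)) S = ENNReal.ofReal (∫ x in S, g x) := by
  rw [withDensity_apply', ofReal_integral_eq_lintegral_ofReal hg (Filter.Eventually.of_forall h0)]

lemma GG_measure {n : ℕ} (sel : (Fin n → ℝ) → ℝ → Prop) (μ ν : Measure (Fin n → ℝ))
    (E : Set (Fin n → ℝ)) (F K : ENNReal)
    (hsel : ∀ b s σ, 0 < s → ¬ sel b s → sel (chd b s σ) (s / 2) →
      K * μ (E ∩ BB (chd b s σ) (s / 2)) ≤ F * ν (BB (chd b s σ) (s / 2))) (k : ℕ) :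
    ∀ b s, 0 < s → ¬ sel b s → K * μ (E ∩ GG sel k b s) ≤ F * ν (BB b s) := by
  induction k with
  | zero => intro b s _ _; simp [GG]
  | succ k ih =>
    intro b s hs hns
    rw [GG, Set.inter_iUnion]
    calc _ ≤ K * ∑ σ, μ (E ∩ _) := by gcongr; exact measure_iUnion_fintype_le _ _
      _ = ∑ σ, K * μ (E ∩ _) := by rw [Finset.mul_sum]
      _ ≤ ∑ σ, F * ν (BB (chd b s σ) (s / 2)) := by
          apply Finset.sum_le_sum
          intro σ _
          split_ifs with h
          · exact hsel b s σ hs hns h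
          · exact ih _ _ (by positivity) h
      _ = F * ν (⋃ σ, BB (chd b s σ) (s / 2)) := by
          rw [measure_iUnion (BB_chd_disj b s) (fun _ => BB_meas _ _), tsum_fintype,
            Finset.mul_sum]
      _ ≤ _ := by
          gcongr
          exact Set.iUnion_subset fun σ => BB_chd_sub b hs σ

lemma core_step {n : ℕ} (w f : (Fin n → ℝ) → ℝ) (A N l : ℝ) (hA : 1 ≤ A) (hN : 0 < N)
    (hl : 0 ≤ l) (F : ENNReal)
    (hw0 : ∀ x, 0 < w x) (hw : LocallyIntegrable w volume) (hf : LocallyIntegrable f volume)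
    (hA1 : ∀ b s, 0 < s → ∀ᵐ x ∂(volume : Measure (Fin n → ℝ)), x ∈ BB b s →
      (∫ x in BB b s, w x) / s ^ n ≤ A * w x)
    (hB : ∀ b s, 0 < s → ∫ x in BB b s, |f x - (∫ x in BB b s, f x) / s ^ n| ≤
      N * ∫ x in BB b s, w x)
    (hF : ∀ b s, 0 < s → (volume.withDensity fun x => ENNReal.ofReal (w x))
      (BB b s ∩ {x | l * w x < |f x - (∫ x in BB b s, f x) / s ^ n|}) ≤
      F * (volume.withDensity fun x => ENNReal.ofReal (w x)) (BB b s))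
    (a : Fin n → ℝ) (r : ℝ) (hr : 0 < r) :
    2 * (volume.withDensity fun x => ENNReal.ofReal (w x))
      (BB a r ∩ {x | (l + 2 ^ (n + 1) * A * N) * w x < |f x - (∫ x in BB a r, f x) / r ^ n|}) ≤
      F * (volume.withDensity fun x => ENNReal.ofReal (w x)) (BB a r) := by
  set μ := volume.withDensity fun x => ENNReal.ofReal (w x) with hμ
  set m := (∫ x in BB a r, f x) / r ^ n with hm
  set h : (Fin n → ℝ) → ℝ := fun x => |f x - m| with hh
  have hhloc : LocallyIntegrable h volume := by
    have : LocallyIntegrable (fun x => f x - m) volume := hf.sub (locallyIntegrable_const m)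
    exact this.mono this.aestronglyMeasurable.norm (by simp [hh])
  have hh0 : ∀ x, 0 ≤ h x := fun x => abs_nonneg _
  set ν := volume.withDensity fun x => ENNReal.ofReal (h x) with hν
  have hac : μ ≪ volume := withDensity_absolutelyContinuous _ _
  set E : Set (Fin n → ℝ) := {x | (l + 2 ^ (n + 1) * A * N) * w x < h x} with hE
  let sel : (Fin n → ℝ) → ℝ → Prop := fun b s => 2 * N * ∫ x in BB b s, w x < ∫ x in BB b s, h x
  have hwpos : ∀ b s, 0 < s → 0 < ∫ x in BB b s, w x := by
    intro b s hs
    rw [setIntegral_pos_iff_support_of_nonneg_ae (Filter.Eventually.of_forall fun x => (hw0 x).le)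
      (BB_int hw b s)]
    have : Function.support w = Set.univ := by
      ext x; simp [(hw0 x).ne']
    rw [this, Set.univ_inter, BB_vol b hs]
    simp; positivity
  have hM : (2 : ℝ) ≤ 2 ^ (n + 1) * A := by
    have : (1 : ℝ) ≤ 2 ^ n := one_le_pow₀ (by norm_num)
    rw [pow_succ]; nlinarith
  have hns : ¬ sel a r := by
    simp only [sel, not_lt]
    have := hB a r hr
    have := hwpos a r hr
    nlinarith
  -- selected children
  have hsel : ∀ b s σ, 0 < s → ¬ sel b s → sel (chd b s σ) (s / 2) →
      ENNReal.ofReal (2 * N) * μ (E ∩ BB (chd b s σ) (s / 2)) ≤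
        F * ν (BB (chd b s σ) (s / 2)) := by
    intro b s σ hs h1 h2
    simp only [sel, not_lt] at h1 h2
    set c := chd b s σ
    have hs2 : 0 < s / 2 := by positivity
    have e1 : μ (E ∩ BB c (s / 2)) ≤ F * μ (BB c (s / 2)) := by
      refine le_trans (measure_mono_ae ?_) (hF c (s / 2) hs2)
      have hd : |(∫ x in BB c (s / 2), f x) / (s / 2) ^ n - m| ≤
          2 ^ (n + 1) * N * ((∫ x in BB b s, w x) / s ^ n) := by
        have e2 : (∫ x in BB c (s / 2), f x) / (s / 2) ^ n - m =
            (∫ x in BB c (s / 2), (f x - m)) / (s / 2) ^ n := by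
          rw [integral_sub (BB_int hf _ _) (BB_int (locallyIntegrable_const m) _ _)]
          rw [setIntegral_const, measureReal_def, BB_vol c hs2,
            ENNReal.toReal_ofReal (by positivity)]
          have : (s / 2) ^ n ≠ 0 := by positivity
          rw [sub_div, smul_eq_mul, mul_div_cancel_left₀ _ this]
        rw [e2, abs_div, abs_of_pos (show 0 < (s / 2) ^ n by positivity), div_le_iff₀ (by positivity)]
        calc |∫ x in BB c (s / 2), (f x - m)| ≤ ∫ x in BB c (s / 2), h x :=
              abs_integral_le_integral_abs
          _ ≤ ∫ x in BB b s, h x :=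
              setIntegral_mono_set (BB_int hhloc b s) (Filter.Eventually.of_forall hh0)
                (BB_chd_sub b hs σ).eventuallyLE
          _ ≤ _ := h1
          _ = _ := by
              rw [div_pow, pow_succ]
              field_simp
      have hae := hA1 b s hs
      filter_upwards [hac.ae_le hae] with x hx hxE
      obtain ⟨hxE, hxB⟩ := hxE
      have hx := hx (BB_chd_sub b hs σ hxB)
      refine ⟨hxB, ?_⟩
      simp only [hE, hh, Set.mem_ofPred_eq] at hxE ⊢
      have t := abs_add_le (f x - (∫ x in BB c (s / 2), f x) / (s / 2) ^ n)
        ((∫ x in BB c (s / 2), f x) / (s / 2) ^ n - m)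
      rw [sub_add_sub_cancel] at t
      have : 2 ^ (n + 1) * N * ((∫ x in BB b s, w x) / s ^ n) ≤ 2 ^ (n + 1) * N * (A * w x) := by
        gcongr
      nlinarith
    have e3 : ENNReal.ofReal (2 * N) * μ (BB c (s / 2)) ≤ ν (BB c (s / 2)) := by
      rw [hμ, hν, wd_eq (BB_int hw _ _) (fun x => (hw0 x).le), wd_eq (BB_int hhloc _ _) hh0,
        ← ENNReal.ofReal_mul (by positivity)]
      exact ENNReal.ofReal_le_ofReal h2.le
    calc _ ≤ ENNReal.ofReal (2 * N) * (F * μ (BB c (s / 2))) := by gcongr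
      _ = F * (ENNReal.ofReal (2 * N) * μ (BB c (s / 2))) := by ring
      _ ≤ _ := by gcongr
  have hmain := fun k => GG_measure sel μ ν E F (ENNReal.ofReal (2 * N)) hsel k a r hr hns
  -- differentiation
  have hdiff : ∀ᵐ x ∂(volume : Measure (Fin n → ℝ)), x ∈ BB a r ∩ E →
      x ∈ ⋃ k, E ∩ GG sel k a r := by
    have hg : LocallyIntegrable (fun x => h x - 2 * N * w x) volume :=
      hhloc.sub (hw.smul (2 * N))
    filter_upwards [IsUnifLocDoublingMeasure.ae_tendsto_average volume hg 1] with x hx hxE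
    obtain ⟨hxB, hxE⟩ := hxE
    by_contra hcon
    have hk : ∀ k, x ∉ GG sel k a r := by
      intro k hk
      exact hcon (Set.mem_iUnion.2 ⟨k, hxE, hk⟩)
    have hch := fun k => GG_chain sel x k a r hr hns hxB (hk k)
    choose b hb1 hb2 using hch
    have hspos : ∀ k : ℕ, 0 < r / 2 ^ k := fun k => by positivity
    have hlim := @hx ℕ Filter.atTop (fun k i => b k i + r / 2 ^ k / 2) (fun k => r / 2 ^ k / 2)
      (by
        rw [tendsto_nhdsWithin_iff]
        refine ⟨?_, Filter.Eventually.of_forall fun k => by simp; positivity⟩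
        have := (tendsto_pow_atTop_nhds_zero_of_lt_one (r := (1 / 2 : ℝ)) (by norm_num)
          (by norm_num)).const_mul (r / 2)
        rw [mul_zero] at this
        refine this.congr fun k => ?_
        rw [one_div, inv_pow]; ring)
      (Filter.Eventually.of_forall fun k => by
        have := hspos k
        have hm := mem_BB.1 (hb2 k)
        rw [one_mul, closedBall_pi _ (by positivity)]
        intro i _
        show x i ∈ Metric.closedBall (b k i + r / 2 ^ k / 2) (r / 2 ^ k / 2)
        rw [Real.closedBall_eq_Icc]
        constructor <;> linarith [(hm i).1, (hm i).2])
    have hle : h x - 2 * N * w x ≤ 0 := by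
      refine le_of_tendsto hlim (Filter.Eventually.of_forall fun k => ?_)
      rw [setAverage_eq, ← setIntegral_congr_set (BB_ae_ball (b k) (hspos k)),
        integral_sub (BB_int hhloc _ _) ((BB_int hw _ _).const_mul _), integral_const_mul]
      have := hb1 k
      simp only [sel, not_lt] at this
      exact mul_nonpos_of_nonneg_of_nonpos (by positivity) (by linarith)
    simp only [hE, Set.mem_ofPred_eq] at hxE
    have := hw0 x
    have : 2 * N * w x ≤ (l + 2 ^ (n + 1) * A * N) * w x := by
      gcongr
      nlinarith
    linarith
  have hfin : ENNReal.ofReal (2 * N) * μ (BB a r ∩ E) ≤ F * ν (BB a r) := by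
    calc _ ≤ ENNReal.ofReal (2 * N) * μ (⋃ k, E ∩ GG sel k a r) := by
          gcongr 1
          exact measure_mono_ae (hac.ae_le hdiff)
      _ = ⨆ k, ENNReal.ofReal (2 * N) * μ (E ∩ GG sel k a r) := by
          rw [Monotone.measure_iUnion, ENNReal.mul_iSup]
          exact monotone_nat_of_le_succ fun k =>
            Set.inter_subset_inter_right _ (GG_mono sel k a r)
      _ ≤ _ := iSup_le hmain
  have hνμ : ν (BB a r) ≤ ENNReal.ofReal N * μ (BB a r) := by
    rw [hμ, hν, wd_eq (BB_int hw _ _) (fun x => (hw0 x).le), wd_eq (BB_int hhloc _ _) hh0,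
        ← ENNReal.ofReal_mul (by positivity)]
    exact ENNReal.ofReal_le_ofReal (hB a r hr)
  have hN0 : ENNReal.ofReal N ≠ 0 := by simpa using hN
  rw [← ENNReal.mul_le_mul_iff_right hN0 ENNReal.ofReal_ne_top]
  calc _ = ENNReal.ofReal (2 * N) * μ (BB a r ∩ E) := by
        rw [ENNReal.ofReal_mul (by norm_num)]; simp; ring
    _ ≤ F * ν (BB a r) := hfin
    _ ≤ F * (ENNReal.ofReal N * μ (BB a r)) := by gcongr
    _ = _ := by ring

lemma core {n : ℕ} (w f : (Fin n → ℝ) → ℝ) (A N : ℝ) (hA : 1 ≤ A) (hN : 0 < N)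
    (hw0 : ∀ x, 0 < w x) (hw : LocallyIntegrable w volume) (hf : LocallyIntegrable f volume)
    (hA1 : ∀ b s, 0 < s → ∀ᵐ x ∂(volume : Measure (Fin n → ℝ)), x ∈ BB b s →
      (∫ x in BB b s, w x) / s ^ n ≤ A * w x)
    (hB : ∀ b s, 0 < s → ∫ x in BB b s, |f x - (∫ x in BB b s, f x) / s ^ n| ≤
      N * ∫ x in BB b s, w x) (k : ℕ) :
    ∀ b s, 0 < s → ∫ x in
      (BB b s ∩ {x | (k * (2 ^ (n + 1) * A * N)) * w x < |f x - (∫ x in BB b s, f x) / s ^ n|}), w x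
      ≤ (1 / 2) ^ k * ∫ x in BB b s, w x := by
  have key : ∀ b s, 0 < s → (volume.withDensity fun x => ENNReal.ofReal (w x))
      (BB b s ∩ {x | (k * (2 ^ (n + 1) * A * N)) * w x < |f x - (∫ x in BB b s, f x) / s ^ n|}) ≤
      (1 / 2) ^ k * (volume.withDensity fun x => ENNReal.ofReal (w x)) (BB b s) := by
    induction k with
    | zero =>
      intro b s hs
      simp only [pow_zero, one_mul]
      exact measure_mono Set.inter_subset_left
    | succ k ih =>
      intro b s hs
      have := core_step w f A N (k * (2 ^ (n + 1) * A * N)) hA hN (by positivity) _ hw0 hw hf hA1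
        hB ih b s hs
      rw [← ENNReal.mul_le_mul_iff_right (a := 2) (by norm_num) (by norm_num)]
      have e : ((k + 1 : ℕ) : ℝ) * (2 ^ (n + 1) * A * N) =
        k * (2 ^ (n + 1) * A * N) + 2 ^ (n + 1) * A * N := by push_cast; ring
      rw [e]
      refine this.trans (le_of_eq ?_)
      rw [pow_succ', ← mul_assoc, ← mul_assoc, one_div,
        ENNReal.mul_inv_cancel (by norm_num) (by norm_num), one_mul]
  intro b s hs
  have h0 : 0 ≤ ∫ x in BB b s, w x := integral_nonneg fun x => (hw0 x).le
  have := key b s hs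
  rw [wd_eq (BB_int hw _ _) (fun x => (hw0 x).le),
    wd_eq ((BB_int hw _ _).mono_set Set.inter_subset_left) (fun x => (hw0 x).le)] at this
  have e : ((1 / 2 : ENNReal)) ^ k = ENNReal.ofReal ((1 / 2) ^ k) := by
    rw [ENNReal.ofReal_pow (by norm_num), ENNReal.ofReal_div_of_pos (by norm_num)]; simp
  rw [e, ← ENNReal.ofReal_mul (by positivity)] at this
  exact (ENNReal.ofReal_le_ofReal_iff (by positivity)).1 this

lemma BB_wpos {n : ℕ} {w : (Fin n → ℝ) → ℝ} (hw0 : ∀ x, 0 < w x)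
    (hw : LocallyIntegrable w volume) (b : Fin n → ℝ) {s : ℝ} (hs : 0 < s) :
    0 < ∫ x in BB b s, w x := by
  rw [setIntegral_pos_iff_support_of_nonneg_ae (Filter.Eventually.of_forall fun x => (hw0 x).le)
    (BB_int hw b s)]
  have : Function.support w = Set.univ := by
    ext x; simp [(hw0 x).ne']
  rw [this, Set.univ_inter, BB_vol b hs]
  simp; positivity

lemma cube_preimage {n : ℕ} (c : Rn n) (r : ℝ) :
    (WithLp.toLp 2 : (Fin n → ℝ) → Rn n) ⁻¹' (cube c r) =
      Set.Icc (fun i => c i - r / 2) (fun i => c i - r / 2 + r) := by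
  ext y
  simp only [cube, Set.mem_preimage, Set.mem_ofPred_eq, Set.mem_Icc, Pi.le_def, abs_le]
  constructor
  · intro h
    exact ⟨fun i => by linarith [(h i).1], fun i => by linarith [(h i).2]⟩
  · intro h i
    constructor <;> linarith [h.1 i, h.2 i]

lemma cube_compact {n : ℕ} (c : Rn n) (r : ℝ) : IsCompact (cube c r) := by
  have h : cube c r = (WithLp.toLp 2 : (Fin n → ℝ) → Rn n) ''
      (Set.Icc (fun i => c i - r / 2) (fun i => c i - r / 2 + r)) := by
    rw [← cube_preimage, Set.image_preimage_eq _ (WithLp.toLp_surjective 2)]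
  rw [h]
  exact isCompact_Icc.image (PiLp.continuous_toLp 2 _)

lemma toLp_emb {n : ℕ} : MeasurableEmbedding (WithLp.toLp 2 : (Fin n → ℝ) → Rn n) :=
  (MeasurableEquiv.toLp 2 (Fin n → ℝ)).measurableEmbedding

lemma cube_inter_integral {n : ℕ} (g : Rn n → ℝ) (c : Rn n) (r : ℝ) (T : Set (Rn n)) :
    ∫ x in cube c r ∩ T, g x = ∫ y in BB (fun i => c i - r / 2) r ∩
      (WithLp.toLp 2 : (Fin n → ℝ) → Rn n) ⁻¹' T, g (WithLp.toLp 2 y) := by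
  rw [← (PiLp.volume_preserving_toLp (Fin n)).setIntegral_preimage_emb toLp_emb,
    Set.preimage_inter, cube_preimage]
  apply setIntegral_congr_set
  exact ((BB_ae_Icc (fun i => c i - r / 2) r).inter (Filter.EventuallyEq.refl _ _)).symm

lemma cube_integral {n : ℕ} (g : Rn n → ℝ) (c : Rn n) (r : ℝ) :
    ∫ x in cube c r, g x = ∫ y in BB (fun i => c i - r / 2) r, g (WithLp.toLp 2 y) := by
  have := cube_inter_integral g c r Set.univ
  simpa using this

lemma BB_integral {n : ℕ} (g : Rn n → ℝ) (b : Fin n → ℝ) (r : ℝ) :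
    ∫ y in BB b r, g (WithLp.toLp 2 y) =
      ∫ x in cube (WithLp.toLp 2 (fun i => b i + r / 2)) r, g x := by
  rw [cube_integral]
  simp

lemma locInt_toLp {n : ℕ} {g : Rn n → ℝ} (hg : LocallyIntegrable g volume) :
    LocallyIntegrable (fun y : Fin n → ℝ => g (WithLp.toLp 2 y)) volume := by
  rw [locallyIntegrable_iff]
  intro K hK
  have h1 := hg.integrableOn_isCompact (hK.image (PiLp.continuous_toLp 2 _))
  rw [← (PiLp.volume_preserving_toLp (Fin n)).integrableOn_comp_preimage toLp_emb,
    Set.preimage_image_eq _ (WithLp.toLp_injective 2)] at h1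
  exact h1

lemma wMeas_cube_pos {n : ℕ} {ω : Rn n → ℝ} (hw0 : ∀ x, 0 < ω x)
    (hw : LocallyIntegrable ω volume) (c : Rn n) {r : ℝ} (hr : 0 < r) :
    0 < wMeas ω (cube c r) := by
  rw [wMeas, cube_integral]
  exact BB_wpos (fun y => hw0 _) (locInt_toLp hw) _ hr

lemma jn {n : ℕ} (ω f : Rn n → ℝ) (A N : ℝ) (hω : IsA1 ω A) (hf : LocallyIntegrable f volume)
    (hN : 0 < N)
    (hB : ∀ (c : Rn n) (ρ : ℝ), 0 < ρ →
      (wMeas ω (cube c ρ))⁻¹ * ∫ x in cube c ρ, |f x - avg f c ρ| ≤ N)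
    (k : ℕ) (c : Rn n) (ρ : ℝ) (hρ : 0 < ρ) :
    wMeas ω {x ∈ cube c ρ | (k * (2 ^ (n + 1) * A * N)) * ω x < |f x - avg f c ρ|} ≤
      (1 / 2) ^ k * wMeas ω (cube c ρ) := by
  obtain ⟨h0, hl, hA, hA1⟩ := hω
  have key := core (fun y : Fin n → ℝ => ω (WithLp.toLp 2 y)) (fun y => f (WithLp.toLp 2 y))
    A N hA hN (fun y => h0 _) (locInt_toLp hl) (locInt_toLp hf) ?_ ?_ k
    (fun i => c i - ρ / 2) ρ hρ
  · have e := cube_inter_integral ω c ρ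
      {x | (k * (2 ^ (n + 1) * A * N)) * ω x < |f x - avg f c ρ|}
    have e2 : {x ∈ cube c ρ | (k * (2 ^ (n + 1) * A * N)) * ω x < |f x - avg f c ρ|} =
      cube c ρ ∩ {x | (k * (2 ^ (n + 1) * A * N)) * ω x < |f x - avg f c ρ|} := rfl
    rw [wMeas, wMeas, e2, e, cube_integral]
    unfold avg
    rw [cube_integral f]
    exact key
  · intro b s hs
    have := hA1 (WithLp.toLp 2 (fun i => b i + s / 2)) s hs
    have := (PiLp.volume_preserving_toLp (Fin n)).quasiMeasurePreserving.ae this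
    filter_upwards [this] with y hy hyB
    rw [BB_integral]
    apply hy
    rw [mem_BB] at hyB
    intro i
    simp only [abs_le]
    constructor <;> linarith [(hyB i).1, (hyB i).2]
  · intro b s hs
    have := hB (WithLp.toLp 2 (fun i => b i + s / 2)) s hs
    have hp := wMeas_cube_pos h0 hl (WithLp.toLp 2 (fun i => b i + s / 2)) hs
    rw [inv_mul_le_iff₀ hp] at this
    rw [BB_integral f, BB_integral ω, BB_integral (fun x => |f x -
      (∫ x in cube (WithLp.toLp 2 (fun i => b i + s / 2)) s, f x) / s ^ n|), mul_comm N]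
    exact this

lemma dir1 {n : ℕ} (ω f : Rn n → ℝ) (p N : ℝ) (hp : 1 < p) (hω0 : ∀ x, 0 < ω x)
    (hω : LocallyIntegrable ω volume) (hf : LocallyIntegrable f volume) (hN : 0 < N)
    (c : Rn n) (ρ : ℝ) (hρ : 0 < ρ)
    (h : ∀ l : ℝ, 0 < l →
      l * (wMeas ω {x ∈ cube c ρ | l * ω x < |f x - avg f c ρ|}) ^ (1 / p) ≤
              N * (wMeas ω (cube c ρ)) ^ (1 / p)) :
    ∫ x in cube c ρ, |f x - avg f c ρ| ≤ (1 + 1 / (p - 1)) * N * wMeas ω (cube c ρ) := by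
  set m := avg f c ρ
  set Q := cube c ρ with hQ
  have hW := wMeas_cube_pos hω0 hω c hρ
  have hp0 : 0 < p := by linarith
  have hQm : MeasurableSet Q := (cube_compact c ρ).isClosed.measurableSet
  have hωQ : IntegrableOn ω Q volume := hω.integrableOn_isCompact (cube_compact c ρ)
  have hfQ : IntegrableOn (fun x => |f x - m|) Q volume :=
    Integrable.norm ((hf.integrableOn_isCompact (cube_compact c ρ)).sub
      ((locallyIntegrable_const m).integrableOn_isCompact (cube_compact c ρ)))
  have hd : ∀ l : ℝ, 0 < l → wMeas ω {x ∈ Q | l * ω x < |f x - m|} ≤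
      N ^ p * l ^ (-p) * wMeas ω Q := by
    intro l hl
    have hE0 : 0 ≤ wMeas ω {x ∈ Q | l * ω x < |f x - m|} :=
      integral_nonneg fun x => (hω0 x).le
    have h1 := h l hl
    have h2 := Real.rpow_le_rpow (by positivity) h1 hp0.le
    rw [Real.mul_rpow hl.le (by positivity), Real.mul_rpow hN.le (by positivity),
      ← Real.rpow_mul hE0, ← Real.rpow_mul hW.le, one_div, inv_mul_cancel₀ hp0.ne',
      Real.rpow_one, Real.rpow_one] at h2
    rw [Real.rpow_neg hl.le]
    have : 0 < l ^ p := by positivity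
    rw [mul_comm (l ^ p), ← le_div_iff₀ this] at h2
    refine h2.trans (le_of_eq ?_)
    rw [← hQ]
    field_simp
  set μ := (volume.restrict Q).withDensity fun x => ENNReal.ofReal (ω x) with hμ
  have hωm : AEMeasurable (fun x => ENNReal.ofReal (ω x)) (volume.restrict Q) :=
    hωQ.aestronglyMeasurable.aemeasurable.ennreal_ofReal
  have hgm : AEMeasurable (fun x => |f x - m| / ω x) (volume.restrict Q) :=
    hfQ.aestronglyMeasurable.aemeasurable.div hωQ.aestronglyMeasurable.aemeasurable
  have hgm' : AEMeasurable (fun x => |f x - m| / ω x) μ :=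
    hgm.mono_ac (withDensity_absolutelyContinuous _ _)
  have hset : ∀ t : ℝ, μ {x | t < |f x - m| / ω x} =
      ENNReal.ofReal (wMeas ω {x ∈ Q | t * ω x < |f x - m|}) := by
    intro t
    have hsub : {x ∈ Q | t * ω x < |f x - m|} ⊆ Q := fun x hx => hx.1
    rw [wMeas, ofReal_integral_eq_lintegral_ofReal (hωQ.mono_set hsub)
      (Filter.Eventually.of_forall fun x => (hω0 x).le), hμ, withDensity_apply',
      Measure.restrict_restrict' hQm]
    congr 2
    ext x
    simp only [Set.mem_inter_iff, Set.mem_ofPred_eq, lt_div_iff₀ (hω0 x)]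
    tauto
  have hlay : ENNReal.ofReal (∫ x in Q, |f x - m|) =
      ∫⁻ t in Set.Ioi (0 : ℝ), ENNReal.ofReal (wMeas ω {x ∈ Q | t * ω x < |f x - m|}) := by
    rw [ofReal_integral_eq_lintegral_ofReal hfQ (Filter.Eventually.of_forall fun x => abs_nonneg _)]
    simp_rw [← hset]
    rw [← lintegral_eq_lintegral_meas_lt μ
      (Filter.Eventually.of_forall fun x => div_nonneg (abs_nonneg _) (hω0 x).le) hgm', hμ,
      lintegral_withDensity_eq_lintegral_mul₀ hωm hgm.ennreal_ofReal]
    refine lintegral_congr fun x => ?_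
    rw [Pi.mul_apply, ← ENNReal.ofReal_mul (hω0 x).le, mul_div_cancel₀ _ (hω0 x).ne']
  have hsplit : Set.Ioi (0 : ℝ) = Set.Ioc 0 N ∪ Set.Ioi N := by
    rw [Set.Ioc_union_Ioi_eq_Ioi hN.le]
  have hb1 : ∫⁻ t in Set.Ioc (0 : ℝ) N,
      ENNReal.ofReal (wMeas ω {x ∈ Q | t * ω x < |f x - m|}) ≤
      ENNReal.ofReal (N * wMeas ω Q) := by
    calc _ ≤ ∫⁻ t in Set.Ioc (0 : ℝ) N, ENNReal.ofReal (wMeas ω Q) := by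
          refine lintegral_mono fun t => ENNReal.ofReal_le_ofReal ?_
          exact setIntegral_mono_set hωQ (Filter.Eventually.of_forall fun x => (hω0 x).le)
            (Filter.Eventually.of_forall fun x hx => hx.1)
      _ = _ := by
          rw [setLIntegral_const, Real.volume_Ioc, sub_zero, ← ENNReal.ofReal_mul hW.le, mul_comm]
  have hb2 : ∫⁻ t in Set.Ioi N,
      ENNReal.ofReal (wMeas ω {x ∈ Q | t * ω x < |f x - m|}) ≤
      ENNReal.ofReal (N / (p - 1) * wMeas ω Q) := by
    have hint : IntegrableOn (fun t : ℝ => N ^ p * t ^ (-p) * wMeas ω Q) (Set.Ioi N) volume :=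
      ((integrableOn_Ioi_rpow_of_lt (by linarith) hN).const_mul _).mul_const _
    calc _ ≤ ∫⁻ t in Set.Ioi N, ENNReal.ofReal (N ^ p * t ^ (-p) * wMeas ω Q) := by
          refine setLIntegral_mono' measurableSet_Ioi fun t ht => ENNReal.ofReal_le_ofReal ?_
          exact hd t (hN.trans ht)
      _ = ENNReal.ofReal (∫ t in Set.Ioi N, N ^ p * t ^ (-p) * wMeas ω Q) := by
          rw [ofReal_integral_eq_lintegral_ofReal hint]
          filter_upwards [ae_restrict_mem measurableSet_Ioi] with t ht
          have : 0 < t := hN.trans ht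
          simp only [Pi.zero_apply]
          positivity
      _ = _ := by
          congr 1
          rw [integral_mul_const, integral_const_mul, integral_Ioi_rpow_of_lt (by linarith) hN]
          congr 1
          have e : N ^ p * N ^ (-p + 1) = N := by
            rw [← Real.rpow_add hN]; simp
          have h3 : -p + 1 ≠ 0 := by linarith
          have h4 : p - 1 ≠ 0 := by linarith
          have e2 : -p + 1 = -(p - 1) := by ring
          calc N ^ p * (-N ^ (-p + 1) / (-p + 1)) = (N ^ p * N ^ (-p + 1)) / (p - 1) := by
                rw [e2, neg_div_neg_eq]; ring
            _ = _ := by rw [e]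
  have hfin : ENNReal.ofReal (∫ x in Q, |f x - m|) ≤
      ENNReal.ofReal ((1 + 1 / (p - 1)) * N * wMeas ω Q) := by
    have hp1 : 0 < p - 1 := by linarith
    rw [hlay, hsplit]
    refine (lintegral_union_le _ _ _).trans ((add_le_add hb1 hb2).trans (le_of_eq ?_))
    rw [← ENNReal.ofReal_add (by positivity) (by positivity)]
    congr 1; ring
  have hp1 : 0 < p - 1 := by linarith
  exact (ENNReal.ofReal_le_ofReal_iff (by positivity)).1 hfin

lemma exists_C0 (p : ℝ) (hp : 1 < p) :
    ∃ C0 : ℝ, 0 ≤ C0 ∧ ∀ k : ℕ, ((k : ℝ) + 1) * ((1 / 2 : ℝ) ^ k) ^ (1 / p) ≤ C0 := by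
  have hp0 : 0 < p := by linarith
  set q : ℝ := (1 / 2 : ℝ) ^ (1 / p) with hq
  have hq0 : 0 < q := by positivity
  have hq1 : q < 1 := Real.rpow_lt_one (by norm_num) (by norm_num) (by positivity)
  have t1 := tendsto_self_mul_const_pow_of_lt_one hq0.le hq1
  have t2 := tendsto_pow_atTop_nhds_zero_of_lt_one hq0.le hq1
  obtain ⟨B, hB⟩ := (t1.add t2).bddAbove_range
  refine ⟨max B 0, le_max_right _ _, fun k => le_max_of_le_left ?_⟩
  have := hB ⟨k, rfl⟩
  refine le_trans (le_of_eq ?_) this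
  show _ = (k : ℝ) * q ^ k + q ^ k
  rw [hq, ← Real.rpow_natCast, ← Real.rpow_natCast, ← Real.rpow_mul (by norm_num),
    ← Real.rpow_mul (by norm_num), mul_comm (k : ℝ) (1 / p)]
  ring

lemma dir2 {n : ℕ} (ω f : Rn n → ℝ) (p A N C0 : ℝ) (hp : 1 < p) (hω : IsA1 ω A)
    (hf : LocallyIntegrable f volume) (hN : 0 < N)
    (hC0 : ∀ k : ℕ, ((k : ℝ) + 1) * ((1 / 2 : ℝ) ^ k) ^ (1 / p) ≤ C0)
    (hB : ∀ (c : Rn n) (ρ : ℝ), 0 < ρ →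
      (wMeas ω (cube c ρ))⁻¹ * ∫ x in cube c ρ, |f x - avg f c ρ| ≤ N)
    (c : Rn n) (ρ : ℝ) (hρ : 0 < ρ) (l : ℝ) (hl : 0 < l) :
    l * (wMeas ω {x ∈ cube c ρ | l * ω x < |f x - avg f c ρ|}) ^ (1 / p) ≤
      (2 ^ (n + 1) * A * C0) * N * (wMeas ω (cube c ρ)) ^ (1 / p) := by
  have hp0 : 0 < p := by linarith
  have hA : 1 ≤ A := hω.2.2.1
  have hW := wMeas_cube_pos hω.1 hω.2.1 c hρ
  set D := 2 ^ (n + 1) * A * N with hD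
  have hD0 : 0 < D := by positivity
  set k := ⌊l / D⌋₊ with hk
  have hk1 : k * D ≤ l := by
    rw [← le_div_iff₀ hD0]; exact Nat.floor_le (by positivity)
  have hk2 : l ≤ (k + 1) * D := by
    rw [← div_le_iff₀ hD0]; exact (Nat.lt_floor_add_one _).le
  have h1 := jn ω f A N hω hf hN hB k c ρ hρ
  have h2 : wMeas ω {x ∈ cube c ρ | l * ω x < |f x - avg f c ρ|} ≤
      wMeas ω {x ∈ cube c ρ | (k * D) * ω x < |f x - avg f c ρ|} := by
    refine setIntegral_mono_set
      ((hω.2.1.integrableOn_isCompact (cube_compact c ρ)).mono_set fun x hx => hx.1)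
      (Filter.Eventually.of_forall fun x => (hω.1 x).le)
      (Filter.Eventually.of_forall fun x hx => ⟨hx.1, ?_⟩)
    exact lt_of_le_of_lt (mul_le_mul_of_nonneg_right hk1 (hω.1 x).le) hx.2
  have h0 : 0 ≤ wMeas ω {x ∈ cube c ρ | l * ω x < |f x - avg f c ρ|} :=
    integral_nonneg fun x => (hω.1 x).le
  calc _ ≤ ((k + 1) * D) * ((1 / 2) ^ k * wMeas ω (cube c ρ)) ^ (1 / p) := by
        gcongr
        exact h2.trans h1
    _ = D * (((k : ℝ) + 1) * ((1 / 2 : ℝ) ^ k) ^ (1 / p)) * (wMeas ω (cube c ρ)) ^ (1 / p) := by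
        rw [Real.mul_rpow (by positivity) hW.le]; ring
    _ ≤ D * C0 * (wMeas ω (cube c ρ)) ^ (1 / p) := by
        gcongr
        exact hC0 k
    _ = _ := by rw [hD]; ring

/-- for `ω ∈ A₁` and `1 < p < ∞`, the weak-type quantity
`‖f‖_{BMO_X(ω)} = sup_Q ω(Q)^{-1/p} ‖(f-f_Q)ω⁻¹ χ_Q‖_{L^{p,∞}(ω)}` is equivalent to
`‖f‖_{BMO(ω)} = sup_Q ω(Q)⁻¹ ∫_Q |f - f_Q|`. -/
theorem stmt4 (n : ℕ) (p A : ℝ) (hp : 1 < p) (hA : 1 ≤ A) :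
    ∃ C : ℝ, 1 ≤ C ∧
      ∀ (ω f : Rn n → ℝ), IsA1 ω A → LocallyIntegrable f volume →
        ∀ N : ℝ, 0 ≤ N →
        -- `‖f‖_{BMO(ω)} ≤ C ‖f‖_{BMO_X(ω)}`
        (((∀ (c : Rn n) (ρ : ℝ), 0 < ρ → ∀ l : ℝ, 0 < l →
            l * (wMeas ω {x ∈ cube c ρ | l * ω x < |f x - avg f c ρ|}) ^ (1 / p) ≤
              N * (wMeas ω (cube c ρ)) ^ (1 / p)) →
          ∀ (c : Rn n) (ρ : ℝ), 0 < ρ →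
            (wMeas ω (cube c ρ))⁻¹ * ∫ x in cube c ρ, |f x - avg f c ρ| ≤ C * N) ∧
        -- `‖f‖_{BMO_X(ω)} ≤ C ‖f‖_{BMO(ω)}`
        ((∀ (c : Rn n) (ρ : ℝ), 0 < ρ →
            (wMeas ω (cube c ρ))⁻¹ * ∫ x in cube c ρ, |f x - avg f c ρ| ≤ N) →
          ∀ (c : Rn n) (ρ : ℝ), 0 < ρ → ∀ l : ℝ, 0 < l →
            l * (wMeas ω {x ∈ cube c ρ | l * ω x < |f x - avg f c ρ|}) ^ (1 / p) ≤
              C * N * (wMeas ω (cube c ρ)) ^ (1 / p))) := by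
  obtain ⟨C0, hC00, hC0⟩ := exists_C0 p hp
  have hp1 : 0 < p - 1 := by linarith
  have hlim : ∀ {a b N : ℝ}, 0 ≤ b → (∀ N', N < N' → a ≤ b * N') → a ≤ b * N := by
    intro a b N hb hN
    have ht : Filter.Tendsto (fun x => b * x) (nhdsWithin N (Set.Ioi N)) (nhds (b * N)) :=
      ((continuous_const.mul continuous_id).tendsto N).mono_left nhdsWithin_le_nhds
    refine ge_of_tendsto ht ?_
    filter_upwards [self_mem_nhdsWithin] with x hx using hN x hx
  refine ⟨1 + 1 / (p - 1) + 2 ^ (n + 1) * A * C0, ?_, ?_⟩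
  · have : 0 ≤ 1 / (p - 1) + 2 ^ (n + 1) * A * C0 := by positivity
    linarith
  intro ω f hω hf N hN
  constructor
  · intro h c ρ hρ
    have hW := wMeas_cube_pos hω.1 hω.2.1 c hρ
    refine hlim (by positivity) fun N' hN' => ?_
    have hN'0 : 0 < N' := lt_of_le_of_lt hN hN'
    have := dir1 ω f p N' hp hω.1 hω.2.1 hf hN'0 c ρ hρ
      fun l hl => (h c ρ hρ l hl).trans (by gcongr)
    rw [inv_mul_le_iff₀ hW]
    have h2 : 0 ≤ 2 ^ (n + 1) * A * C0 * N' * wMeas ω (cube c ρ) := by positivity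
    linarith
  · intro h c ρ hρ l hl
    have hW := wMeas_cube_pos hω.1 hω.2.1 c hρ
    rw [mul_right_comm]
    refine hlim (by positivity) fun N' hN' => ?_
    have hN'0 : 0 < N' := lt_of_le_of_lt hN hN'
    have := dir2 ω f p A N' C0 hp hω hf hN'0 hC0
      (fun c ρ hρ => (h c ρ hρ).trans hN'.le) c ρ hρ l hl
    have h2 : 0 ≤ (1 + 1 / (p - 1)) * N' * (wMeas ω (cube c ρ)) ^ (1 / p) := by positivity
    linarith
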